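/- arXiv:1208.3068 — 2 statements merged into one kernel-verified Lean document; each statement's English description precedes it below -/
import Mathlib

section
/- Let ε ∈ (0,1) and suppose the nonnegative sequence (λ(i))_{i≥1} satisfies ∑_{i=1}^∞ |log λ(i)|² λ(i)² < ∞ and σ > 0. Then lim_{d→∞} (log n(ε,d) − d·log E)/√d = 2q(ε), where E := Λ·e^{2M} and q = q(ε) is the unique real number satisfying 1 − Φ(q/σ) = ε² (Φ being the standard normal distribution function). -/
open scoped BigOperators
open Real MeasureTheory Filter

/-- Λ := ∑ λ(i)². -/
noncomputable def bigLambda (lam : ℕ → ℝ) : ℝ := ∑' i, lam i ^ 2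

/-- tensor eigenvalue λ_k = ∏ λ(k_l). -/
noncomputable def tensorEig (lam : ℕ → ℝ) {d : ℕ} (k : Fin d → ℕ) : ℝ := ∏ l, lam (k l)

/-- relative approximation complexity n(ε,d). -/
noncomputable def complexity (lam : ℕ → ℝ) (ε : ℝ) (d : ℕ) : ℕ :=
  sInf { n : ℕ | ∃ K : Finset (Fin d → ℕ), K.card = n ∧
    (∑' k : {k : Fin d → ℕ // k ∉ K}, tensorEig lam k.1 ^ 2) ≤ ε ^ 2 * bigLambda lam ^ d }

/-- M := −∑ log λ(i) · λ(i)²/Λ. -/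
noncomputable def meanM (lam : ℕ → ℝ) : ℝ :=
  -(∑' i, Real.log (lam i) * lam i ^ 2) / bigLambda lam

/-- σ² := ∑ (log λ(i))² · λ(i)²/Λ − M². -/
noncomputable def sigma2 (lam : ℕ → ℝ) : ℝ :=
  (∑' i, Real.log (lam i) ^ 2 * lam i ^ 2) / bigLambda lam - meanM lam ^ 2

/-- σ. -/
noncomputable def sigma (lam : ℕ → ℝ) : ℝ := Real.sqrt (sigma2 lam)

/-- standard normal distribution function Φ. -/
noncomputable def stdNormalCDF (x : ℝ) : ℝ :=
  ∫ t in Set.Iic x, Real.exp (-t ^ 2 / 2) / Real.sqrt (2 * Real.pi)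


open ProbabilityTheory Topology

/-- The probability measure on `ℕ` with weights `λ(i)² / Λ`. -/
noncomputable def weightMeasure (lam : ℕ → ℝ) : Measure ℕ :=
  Measure.count.withDensity fun i => ENNReal.ofReal (lam i ^ 2 / bigLambda lam)

lemma stdNormalCDF_eq_real (x : ℝ) : stdNormalCDF x = (gaussianReal 0 1).real (Set.Iic x) := by
  rw [measureReal_def, gaussianReal_apply_eq_integral _ one_ne_zero, ENNReal.toReal_ofReal
    (integral_nonneg fun t => gaussianPDFReal_nonneg _ _ _)]
  refine integral_congr_ae (.of_forall fun t => ?_)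
  simp [gaussianPDFReal, div_eq_inv_mul]

lemma stdNormalCDF_strictMono : StrictMono stdNormalCDF := by
  intro a b hab
  have hpos : 0 < (gaussianReal 0 1).real (Set.Ioc a b) := by
    refine ENNReal.toReal_pos (fun h => ?_) (measure_ne_top _ _)
    have := gaussianReal_absolutelyContinuous' 0 one_ne_zero h
    simp at this
    linarith
  have hunion := measureReal_union (μ := gaussianReal 0 1) (Set.Iic_disjoint_Ioc le_rfl)
    (measurableSet_Ioc (a := a) (b := b))
  rw [Set.Iic_union_Ioc_eq_Iic hab.le] at hunion
  rw [stdNormalCDF_eq_real, stdNormalCDF_eq_real, hunion]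
  linarith

lemma gaussianReal_real_Iic {v : NNReal} (hv : v ≠ 0) (x : ℝ) :
    (gaussianReal 0 v).real (Set.Iic x) = stdNormalCDF (x / √v) := by
  have hpos : 0 < √(v : ℝ) := by positivity
  have hmap : (gaussianReal 0 v).map (· / √(v : ℝ)) = gaussianReal 0 1 := by
    rw [gaussianReal_map_div_const]
    congr 1
    · simp
    · ext
      simp [hv]
  rw [stdNormalCDF_eq_real, ← hmap, map_measureReal_apply (by fun_prop) measurableSet_Iic]
  congr 1
  ext y
  simp [div_le_div_iff_of_pos_right hpos]

lemma infinitePi_map_fin {α : Type*} [MeasurableSpace α] (μ : Measure α) [IsProbabilityMeasure μ]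
    (d : ℕ) :
    (Measure.infinitePi fun _ : ℕ => μ).map (fun ω (l : Fin d) => ω l) = Measure.pi fun _ => μ := by
  have h := (iIndepFun_infinitePi (P := fun _ : ℕ => μ) (X := fun _ x => x)
    fun _ => measurable_id).precomp (g := fun l : Fin d => (l : ℕ)) Fin.val_injective
  rw [iIndepFun_iff_map_fun_eq_pi_map fun _ => (measurable_pi_apply _).aemeasurable] at h
  simpa [Measure.infinitePi_map_eval] using h

/-- The central limit theorem for i.i.d. sums on finite product spaces, as convergence of
distribution functions. -/
lemma tendsto_pi_real_sum_le {α : Type*} [MeasurableSpace α] (μ : Measure α)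
    [IsProbabilityMeasure μ] {f : α → ℝ} (hf : Measurable f) (hf2 : MemLp f 2 μ)
    (hvar : 0 < Var[f; μ]) (x : ℝ) :
    Tendsto (fun d : ℕ => (Measure.pi fun _ : Fin d => μ).real
      {k | (√d)⁻¹ * (∑ l, f (k l) - d * μ[f]) ≤ x}) atTop (𝓝 (stdNormalCDF (x / √Var[f; μ]))) := by
  set P := Measure.infinitePi fun _ : ℕ => μ
  have hmp (i : ℕ) : MeasurePreserving (Function.eval i) P μ :=
    measurePreserving_eval_infinitePi (fun _ : ℕ => μ) i
  have hident (i : ℕ) : IdentDistrib (fun ω : ℕ → α => f (ω i)) f P μ :=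
    ⟨(hf.comp (measurable_pi_apply i)).aemeasurable, hf.aemeasurable, by
      rw [← (hmp i).map_eq, Measure.map_map hf (by fun_prop)]
      rfl⟩
  have hv : Var[f; μ].toNNReal ≠ 0 := by simpa using hvar
  have hclt := tendstoInDistribution_inv_sqrt_mul_sum_sub (P := P)
    (X := fun i ω => f (ω i)) (Y := id) (P' := gaussianReal 0 Var[f; μ].toNNReal)
    (by rw [(hident 0).variance_eq]; exact HasLaw.id) ((hident 0).memLp_iff.2 hf2)
    (iIndepFun_infinitePi fun _ => hf) (fun i => (hident i).trans (hident 0).symm)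
  have := nullSingletonClass_gaussianReal (μ := 0) hv
  have key := ProbabilityMeasure.tendsto_measure_of_null_frontier_of_tendsto' hclt.tendsto
    (E := Set.Iic x) (by simp)
  simp only [ProbabilityMeasure.coe_mk, Measure.map_id] at key
  have key2 := (ENNReal.tendsto_toReal (measure_ne_top _ _)).comp key
  convert key2 using 2 with d
  · rw [← infinitePi_map_fin, map_measureReal_apply (by fun_prop)
      (measurableSet_le (by fun_prop) (by fun_prop)), Function.comp_apply]
    rw [Measure.map_apply (by fun_prop) measurableSet_Iic, measureReal_def]
    congr 2
    ext ω
    simp [Finset.sum_range fun i => f (ω i), (hident 0).integral_eq]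
  · rw [← measureReal_def, gaussianReal_real_Iic hv, Real.coe_toNNReal _ hvar.le]

section Weight

variable {lam : ℕ → ℝ}

lemma bigLambda_pos_of_sigma_pos (hσ : 0 < sigma lam) : 0 < bigLambda lam := by
  refine (tsum_nonneg fun i => sq_nonneg _).lt_of_ne' fun h => hσ.ne' ?_
  simp [sigma, sigma2, meanM, bigLambda, h]

lemma weightMeasure_real_singleton (i : ℕ) :
    (weightMeasure lam).real {i} = lam i ^ 2 / bigLambda lam := by
  have : 0 ≤ lam i ^ 2 / bigLambda lam := div_nonneg (sq_nonneg _) (tsum_nonneg fun i => sq_nonneg _)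
  simp [weightMeasure, measureReal_def, withDensity_apply, this]

lemma isProbabilityMeasure_weightMeasure (hΛ : Summable fun i => lam i ^ 2)
    (hpos : 0 < bigLambda lam) : IsProbabilityMeasure (weightMeasure lam) where
  measure_univ := by
    rw [weightMeasure, withDensity_apply _ .univ, Measure.restrict_univ, lintegral_count,
      ← ENNReal.ofReal_tsum_of_nonneg (fun i => by positivity) (hΛ.div_const _), tsum_div_const]
    change ENNReal.ofReal (bigLambda lam / bigLambda lam) = 1
    rw [div_self hpos.ne', ENNReal.ofReal_one]

lemma integrable_weightMeasure_iff {f : ℕ → ℝ} (hpos : 0 < bigLambda lam) :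
    Integrable f (weightMeasure lam) ↔ Summable fun i => |f i| * lam i ^ 2 := by
  rw [weightMeasure, integrable_withDensity_iff_integrable_smul' (by fun_prop) (by simp),
    integrable_count_iff, 
    ← summable_mul_right_iff (f := fun i => |f i| * lam i ^ 2) (inv_ne_zero hpos.ne')]
  refine summable_congr fun i => ?_
  rw [ENNReal.toReal_ofReal (by positivity), norm_smul, Real.norm_eq_abs, Real.norm_eq_abs,
    abs_of_nonneg (by positivity)]
  ring

lemma integral_weightMeasure {f : ℕ → ℝ} (hf : Integrable f (weightMeasure lam)) :
    ∫ i, f i ∂weightMeasure lam = (∑' i, f i * lam i ^ 2) / bigLambda lam := by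
  rw [integral_countable hf, ← tsum_div_const]
  refine tsum_congr fun i => ?_
  rw [weightMeasure_real_singleton, smul_eq_mul]
  ring

lemma memLp_neg_log (hpos : 0 < bigLambda lam)
    (hsum : Summable fun i => |Real.log (lam i)| ^ 2 * lam i ^ 2) :
    MemLp (fun i => -Real.log (lam i)) 2 (weightMeasure lam) := by
  rw [memLp_two_iff_integrable_sq Measurable.of_discrete.aestronglyMeasurable, integrable_weightMeasure_iff hpos]
  simpa using hsum

lemma integral_neg_log (hΛ : Summable fun i => lam i ^ 2) (hpos : 0 < bigLambda lam)
    (hsum : Summable fun i => |Real.log (lam i)| ^ 2 * lam i ^ 2) :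
    ∫ i, -Real.log (lam i) ∂weightMeasure lam = meanM lam := by
  have := isProbabilityMeasure_weightMeasure hΛ hpos
  rw [integral_weightMeasure ((memLp_neg_log hpos hsum).integrable one_le_two), meanM]
  simp [tsum_neg]

lemma variance_neg_log (hΛ : Summable fun i => lam i ^ 2) (hpos : 0 < bigLambda lam)
    (hsum : Summable fun i => |Real.log (lam i)| ^ 2 * lam i ^ 2) :
    Var[fun i => -Real.log (lam i); weightMeasure lam] = sigma2 lam := by
  have := isProbabilityMeasure_weightMeasure hΛ hpos
  rw [variance_eq_sub (memLp_neg_log hpos hsum), integral_neg_log hΛ hpos hsum, sigma2]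
  congr 1
  simp only [Pi.pow_apply]
  rw [integral_weightMeasure (memLp_neg_log hpos hsum).integrable_sq]
  simp

lemma pi_weightMeasure_real_singleton [SigmaFinite (weightMeasure lam)] {d : ℕ} (k : Fin d → ℕ) :
    (Measure.pi fun _ : Fin d => weightMeasure lam).real {k} =
      tensorEig lam k ^ 2 / bigLambda lam ^ d := by
  rw [measureReal_def, Measure.pi_singleton, ENNReal.toReal_prod]
  simp_rw [← measureReal_def, weightMeasure_real_singleton]
  simp [tensorEig, Finset.prod_div_distrib, Finset.prod_pow]

lemma hasSum_tensorEig_sq (hΛ : Summable fun i => lam i ^ 2) (hpos : 0 < bigLambda lam) (d : ℕ) :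
    HasSum (fun k : Fin d → ℕ => tensorEig lam k ^ 2) (bigLambda lam ^ d) := by
  have := isProbabilityMeasure_weightMeasure hΛ hpos
  have htsum : ∑' k : Fin d → ℕ, tensorEig lam k ^ 2 / bigLambda lam ^ d = 1 := by
    have := integral_countable
      (integrable_const (μ := Measure.pi fun _ : Fin d => weightMeasure lam) (1 : ℝ))
    simpa [pi_weightMeasure_real_singleton] using this.symm
  have hs : Summable fun k : Fin d → ℕ => tensorEig lam k ^ 2 / bigLambda lam ^ d := by
    by_contra h
    simp [tsum_eq_zero_of_not_summable h] at htsum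
  have h := hs.hasSum.mul_right (bigLambda lam ^ d)
  rw [htsum, one_mul] at h
  simpa [div_mul_cancel₀ _ (pow_pos hpos d).ne'] using h

lemma tsum_compl_le_iff (hΛ : Summable fun i => lam i ^ 2) (hpos : 0 < bigLambda lam) {d : ℕ}
    (K : Finset (Fin d → ℕ)) (ε : ℝ) :
    (∑' k : {k : Fin d → ℕ // k ∉ K}, tensorEig lam k.1 ^ 2) ≤ ε ^ 2 * bigLambda lam ^ d ↔
      1 - ε ^ 2 ≤ (Measure.pi fun _ : Fin d => weightMeasure lam).real (K : Set (Fin d → ℕ)) := by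
  have := isProbabilityMeasure_weightMeasure hΛ hpos
  have hΛd := pow_pos hpos d
  have hs := hasSum_tensorEig_sq hΛ hpos d
  have htot := hs.summable.sum_add_tsum_subtype_compl K
  rw [hs.tsum_eq] at htot
  rw [← sum_measureReal_singleton]
  simp_rw [pi_weightMeasure_real_singleton]
  rw [← Finset.sum_div, le_div_iff₀ hΛd]
  constructor <;> intro h <;> linarith

/-- The multi-indices whose centred and normalised value of `-log λ_k` is at most `x`. -/
def normalizedLogSublevel (lam : ℕ → ℝ) (d : ℕ) (x : ℝ) : Set (Fin d → ℕ) :=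
  {k | (√d)⁻¹ * (∑ l, -Real.log (lam (k l)) - d * meanM lam) ≤ x}

lemma tendsto_real_normalizedLogSublevel (hΛ : Summable fun i => lam i ^ 2)
    (hsum : Summable fun i => |Real.log (lam i)| ^ 2 * lam i ^ 2) (hσ : 0 < sigma lam) (x : ℝ) :
    Tendsto (fun d : ℕ => (Measure.pi fun _ : Fin d => weightMeasure lam).real
      (normalizedLogSublevel lam d x)) atTop (𝓝 (stdNormalCDF (x / sigma lam))) := by
  have hpos := bigLambda_pos_of_sigma_pos hσ
  have := isProbabilityMeasure_weightMeasure hΛ hpos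
  have hvar := variance_neg_log hΛ hpos hsum
  have key := tendsto_pi_real_sum_le (weightMeasure lam) (f := fun i => -Real.log (lam i))
    .of_discrete (memLp_neg_log hpos hsum) (by rw [hvar]; exact Real.sqrt_pos.1 hσ) x
  rwa [hvar, integral_neg_log hΛ hpos hsum] at key

/-- The threshold on `λ_k` corresponding to `normalizedLogSublevel`. -/
noncomputable def eigThreshold (lam : ℕ → ℝ) (d : ℕ) (x : ℝ) : ℝ :=
  Real.exp (-(d * meanM lam + x * √d))

lemma mem_normalizedLogSublevel_iff (hnn : ∀ i, 0 ≤ lam i) {d : ℕ} (hd : 0 < d) (x : ℝ)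
    {k : Fin d → ℕ} (hk : tensorEig lam k ≠ 0) :
    k ∈ normalizedLogSublevel lam d x ↔ eigThreshold lam d x ≤ tensorEig lam k := by
  have hkpos : 0 < tensorEig lam k := (Finset.prod_nonneg fun l _ => hnn _).lt_of_ne' hk
  have hlog : Real.log (tensorEig lam k) = ∑ l, Real.log (lam (k l)) :=
    Real.log_prod fun l hl => (Finset.prod_ne_zero_iff.1 hk) l hl
  have hsd : 0 < √(d : ℝ) := by positivity
  rw [normalizedLogSublevel, Set.mem_ofPred_eq, inv_mul_le_iff₀ hsd, Finset.sum_neg_distrib, ← hlog,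
    eigThreshold, ← Real.le_log_iff_exp_le hkpos]
  constructor <;> intro h <;> linarith

lemma real_normalizedLogSublevel_le (hΛ : Summable fun i => lam i ^ 2) (hpos : 0 < bigLambda lam)
    (hnn : ∀ i, 0 ≤ lam i) {d : ℕ} (hd : 0 < d) (x : ℝ) :
    (Measure.pi fun _ : Fin d => weightMeasure lam).real (normalizedLogSublevel lam d x) ≤
      (Measure.pi fun _ : Fin d => weightMeasure lam).real
        {k | eigThreshold lam d x ≤ tensorEig lam k} := by
  have := isProbabilityMeasure_weightMeasure hΛ hpos
  set Q := Measure.pi fun _ : Fin d => weightMeasure lam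
  have hnull : Q.real {k | tensorEig lam k = 0} = 0 := by
    rw [measureReal_eq_zero_iff, ← Set.biUnion_of_singleton {k | tensorEig lam k = 0},
      measure_biUnion_null_iff (Set.to_countable _)]
    intro k hk
    rw [← measureReal_eq_zero_iff, pi_weightMeasure_real_singleton, show tensorEig lam k = 0 from hk]
    simp
  calc Q.real (normalizedLogSublevel lam d x)
      ≤ Q.real ({k | eigThreshold lam d x ≤ tensorEig lam k} ∪ {k | tensorEig lam k = 0}) := by
        refine measureReal_mono fun k hk => ?_
        by_cases h0 : tensorEig lam k = 0
        · exact .inr h0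
        · exact .inl ((mem_normalizedLogSublevel_iff hnn hd x h0).1 hk)
    _ ≤ _ := (measureReal_union_le _ _).trans (by rw [hnull, add_zero])

lemma complexity_le (hΛ : Summable fun i => lam i ^ 2) (hpos : 0 < bigLambda lam)
    (hnn : ∀ i, 0 ≤ lam i) {d : ℕ} (hd : 0 < d) {x ε : ℝ}
    (h : 1 - ε ^ 2 ≤ (Measure.pi fun _ : Fin d => weightMeasure lam).real
      (normalizedLogSublevel lam d x)) :
    complexity lam ε d * eigThreshold lam d x ^ 2 ≤ bigLambda lam ^ d := by
  have hr : 0 < eigThreshold lam d x := Real.exp_pos _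
  have hs := hasSum_tensorEig_sq hΛ hpos d
  have hfin : {k : Fin d → ℕ | eigThreshold lam d x ≤ tensorEig lam k}.Finite := by
    refine (hs.summable.tendsto_cofinite_zero.eventually_lt_const (pow_pos hr 2)).subset ?_
    intro k hk
    simpa using pow_le_pow_left₀ hr.le hk 2
  have hle : complexity lam ε d ≤ hfin.toFinset.card := by
    refine Nat.sInf_le ⟨_, rfl, (tsum_compl_le_iff hΛ hpos _ ε).2 ?_⟩
    rw [hfin.coe_toFinset]
    exact h.trans (real_normalizedLogSublevel_le hΛ hpos hnn hd x)
  calc complexity lam ε d * eigThreshold lam d x ^ 2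
      ≤ hfin.toFinset.card * eigThreshold lam d x ^ 2 := by gcongr
    _ = ∑ k ∈ hfin.toFinset, eigThreshold lam d x ^ 2 := by simp
    _ ≤ ∑ k ∈ hfin.toFinset, tensorEig lam k ^ 2 := by
        refine Finset.sum_le_sum fun k hk => pow_le_pow_left₀ hr.le ?_ 2
        simpa using hk
    _ ≤ bigLambda lam ^ d := sum_le_hasSum _ (fun k _ => sq_nonneg _) hs

lemma le_complexity (hΛ : Summable fun i => lam i ^ 2) (hpos : 0 < bigLambda lam)
    (hnn : ∀ i, 0 ≤ lam i) {d : ℕ} (hd : 0 < d) {x ε η : ℝ} (hε : 0 < ε)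
    (h : (Measure.pi fun _ : Fin d => weightMeasure lam).real
      (normalizedLogSublevel lam d x) + η ≤ 1 - ε ^ 2) :
    η * bigLambda lam ^ d ≤ complexity lam ε d * eigThreshold lam d x ^ 2 := by
  classical
  have := isProbabilityMeasure_weightMeasure hΛ hpos
  set Q := Measure.pi fun _ : Fin d => weightMeasure lam with hQ
  have hΛd := pow_pos hpos d
  have hne : { n : ℕ | ∃ K : Finset (Fin d → ℕ), K.card = n ∧
      (∑' k : {k : Fin d → ℕ // k ∉ K}, tensorEig lam k.1 ^ 2) ≤
        ε ^ 2 * bigLambda lam ^ d }.Nonempty := by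
    obtain ⟨K, hK⟩ := ((tendsto_tsum_compl_atTop_zero fun k : Fin d → ℕ =>
      tensorEig lam k ^ 2).eventually_le_const (u := ε ^ 2 * bigLambda lam ^ d)
        (by positivity)).exists
    exact ⟨_, K, rfl, hK⟩
  obtain ⟨K, hcard, hK⟩ := Nat.sInf_mem hne
  rw [tsum_compl_le_iff hΛ hpos] at hK
  set G := normalizedLogSublevel lam d x
  set J := K.filter (· ∉ G)
  have hsub : (K : Set (Fin d → ℕ)) ⊆ G ∪ J := fun k hk => by
    by_cases hG : k ∈ G
    · exact .inl hG
    · exact .inr (by simpa [J, hG] using hk)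
  have hJ : Q.real (J : Set (Fin d → ℕ)) ≤
      complexity lam ε d * (eigThreshold lam d x ^ 2 / bigLambda lam ^ d) := by
    rw [← sum_measureReal_singleton]
    calc ∑ k ∈ J, Q.real {k} ≤ ∑ k ∈ J, eigThreshold lam d x ^ 2 / bigLambda lam ^ d := by
          refine Finset.sum_le_sum fun k hk => ?_
          rw [hQ, pi_weightMeasure_real_singleton]
          have hk0 : 0 ≤ tensorEig lam k := Finset.prod_nonneg fun l _ => hnn _
          have hr : 0 < eigThreshold lam d x := Real.exp_pos _
          have : tensorEig lam k ≤ eigThreshold lam d x := by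
            by_cases h0 : tensorEig lam k = 0
            · rw [h0]; exact hr.le
            · exact (not_le.1 (mt (mem_normalizedLogSublevel_iff hnn hd x h0).2
                (Finset.mem_filter.1 hk).2)).le
          gcongr
      _ = J.card * (eigThreshold lam d x ^ 2 / bigLambda lam ^ d) := by simp
      _ ≤ complexity lam ε d * (eigThreshold lam d x ^ 2 / bigLambda lam ^ d) := by
          gcongr
          rw [complexity, ← hcard]
          exact Finset.card_filter_le _ _
  have hη : η ≤ complexity lam ε d * eigThreshold lam d x ^ 2 / bigLambda lam ^ d := by
    have h1 := (measureReal_mono (μ := Q) hsub).trans (measureReal_union_le _ _)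
    rw [mul_div_assoc]
    linarith
  exact (le_div_iff₀ hΛd).1 hη

lemma log_complexity_le (hΛ : Summable fun i => lam i ^ 2) (hpos : 0 < bigLambda lam)
    (hnn : ∀ i, 0 ≤ lam i) {d : ℕ} (hd : 0 < d) {x ε : ℝ} (hC : 0 < complexity lam ε d)
    (h : 1 - ε ^ 2 ≤ (Measure.pi fun _ : Fin d => weightMeasure lam).real
      (normalizedLogSublevel lam d x)) :
    (Real.log (complexity lam ε d)
      - d * Real.log (bigLambda lam * Real.exp (2 * meanM lam))) / √d ≤ 2 * x := by
  have hsd : 0 < √(d : ℝ) := by positivity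
  have hr : 0 < eigThreshold lam d x := Real.exp_pos _
  have hlog := Real.log_le_log (by positivity) (complexity_le hΛ hpos hnn hd h)
  rw [Real.log_mul (by positivity) (by positivity), Real.log_pow, Real.log_pow, eigThreshold,
    Real.log_exp] at hlog
  rw [div_le_iff₀ hsd, Real.log_mul hpos.ne' (Real.exp_pos _).ne', Real.log_exp]
  push_cast at hlog
  linarith

lemma le_log_complexity (hΛ : Summable fun i => lam i ^ 2) (hpos : 0 < bigLambda lam)
    (hnn : ∀ i, 0 ≤ lam i) {d : ℕ} (hd : 0 < d) {x ε η : ℝ} (hε : 0 < ε) (hη : 0 < η)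
    (hC : 0 < complexity lam ε d)
    (h : (Measure.pi fun _ : Fin d => weightMeasure lam).real
      (normalizedLogSublevel lam d x) + η ≤ 1 - ε ^ 2) :
    Real.log η / √d + 2 * x ≤ (Real.log (complexity lam ε d)
      - d * Real.log (bigLambda lam * Real.exp (2 * meanM lam))) / √d := by
  have hsd : 0 < √(d : ℝ) := by positivity
  have hr : 0 < eigThreshold lam d x := Real.exp_pos _
  have hlog := Real.log_le_log (by positivity) (le_complexity hΛ hpos hnn hd hε h)
  rw [Real.log_mul (by positivity) (by positivity), Real.log_mul (by positivity) (by positivity),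
    Real.log_pow, Real.log_pow, eigThreshold, Real.log_exp] at hlog
  rw [le_div_iff₀ hsd, Real.log_mul hpos.ne' (Real.exp_pos _).ne', Real.log_exp, add_mul,
    div_mul_cancel₀ _ hsd.ne']
  push_cast at hlog
  linarith

end Weight

/-- Theorem 3.2 of Lifshits–Tulyakova: logarithmic asymptotics of the
approximation complexity. -/
theorem complexity_log_asymptotics
    (lam : ℕ → ℝ) (hnn : ∀ i, 0 ≤ lam i)
    (hΛ : Summable fun i => lam i ^ 2)
    (hsum : Summable fun i => |Real.log (lam i)| ^ 2 * lam i ^ 2)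
    (hσ : 0 < sigma lam)
    (ε : ℝ) (hε : ε ∈ Set.Ioo (0 : ℝ) 1)
    (q : ℝ) (hq : 1 - stdNormalCDF (q / sigma lam) = ε ^ 2) :
    Tendsto
      (fun d : ℕ =>
        (Real.log (complexity lam ε d)
          - d * Real.log (bigLambda lam * Real.exp (2 * meanM lam))) / Real.sqrt d)
      atTop (nhds (2 * q)) := by
  have hpos := bigLambda_pos_of_sigma_pos hσ
  have hcdf : stdNormalCDF (q / sigma lam) = 1 - ε ^ 2 := by linarith
  have lower {x : ℝ} (hx : x < q) : ∃ η > 0, ∀ᶠ d : ℕ in atTop,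
      (Measure.pi fun _ : Fin d => weightMeasure lam).real
        (normalizedLogSublevel lam d x) + η ≤ 1 - ε ^ 2 := by
    have hlt : stdNormalCDF (x / sigma lam) < 1 - ε ^ 2 :=
      hcdf ▸ stdNormalCDF_strictMono (div_lt_div_of_pos_right hx hσ)
    obtain ⟨y, hy, hy'⟩ := exists_between hlt
    refine ⟨1 - ε ^ 2 - y, by linarith, ?_⟩
    filter_upwards [(tendsto_real_normalizedLogSublevel hΛ hsum hσ x).eventually_lt_const hy]
      with d hd
    linarith
  have hC : ∀ᶠ d : ℕ in atTop, 0 < complexity lam ε d := by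
    obtain ⟨η, hη, h⟩ := lower (sub_one_lt q)
    filter_upwards [h, eventually_gt_atTop 0] with d h hd
    have := (mul_pos hη (pow_pos hpos d)).trans_le (le_complexity hΛ hpos hnn hd hε.1 h)
    exact_mod_cast pos_of_mul_pos_left this (sq_nonneg _)
  refine tendsto_order.2 ⟨fun a ha => ?_, fun a ha => ?_⟩
  · obtain ⟨x, hax, hxq⟩ := exists_between (show a / 2 < q by linarith)
    obtain ⟨η, hη, h⟩ := lower hxq
    have hlim : Tendsto (fun d : ℕ => Real.log η / √d) atTop (𝓝 0) :=
      (Real.tendsto_sqrt_atTop.comp tendsto_natCast_atTop_atTop).const_div_atTop _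
    filter_upwards [h, hC, eventually_gt_atTop 0,
      hlim.eventually_const_lt (show a - 2 * x < 0 by linarith)] with d h hC hd hlim
    linarith [le_log_complexity hΛ hpos hnn hd hε.1 hη hC h]
  · obtain ⟨x, hqx, hxa⟩ := exists_between (show q < a / 2 by linarith)
    have hlt : 1 - ε ^ 2 < stdNormalCDF (x / sigma lam) :=
      hcdf ▸ stdNormalCDF_strictMono (div_lt_div_of_pos_right hqx hσ)
    filter_upwards [(tendsto_real_normalizedLogSublevel hΛ hsum hσ x).eventually_const_lt hlt,
      hC, eventually_gt_atTop 0] with d h hC hd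
    linarith [log_complexity_le hΛ hpos hnn hd hC h.le]
end

section
/- Let σ > 0, c ∈ ℝ, and let (θ_d)_{d≥1} be a sequence of real numbers with θ_d → c as d → ∞. Then lim_{d→∞} √d · ∫_{−∞}^{θ_d} exp( 2σ√d·(z − θ_d) ) · exp( −z²/2 ) dz = e^{−c²/2} / (2σ). -/
open Real MeasureTheory Filter

/-- Rescaling of a left half-line integral around its endpoint. -/
theorem mul_setIntegral_Iic_eq_setIntegral_Iic_zero (F : ℝ → ℝ) (t : ℝ) {r : ℝ} (hr : 0 < r) :
    r * ∫ z in Set.Iic t, F z = ∫ u in Set.Iic 0, F (t + u / r) := by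
  rw [← integral_indicator measurableSet_Iic, ← integral_indicator measurableSet_Iic,
    ← integral_add_left_eq_self _ t]
  have h := Measure.integral_comp_div (fun x => (Set.Iic t).indicator F (t + x)) r
  rw [abs_of_pos hr, smul_eq_mul] at h
  rw [← h]
  congr 1 with u
  simp only [Set.indicator_apply, Set.mem_Iic, add_le_iff_nonpos_right, div_nonpos_iff,
    hr.le, hr.not_ge, and_true, and_false, false_or]

/-- An exponential kernel with rate tending to infinity, integrated over a half-line whose
endpoint converges, concentrates at the limit of the endpoints. -/
theorem tendsto_mul_setIntegral_Iic_exp_mul {ι : Type*} {l : Filter ι} [l.IsCountablyGenerated]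
    {g : ℝ → ℝ} (hg : Continuous g) {C : ℝ} (hC : ∀ x, |g x| ≤ C) {a : ℝ} (ha : 0 < a)
    {r t : ι → ℝ} {c : ℝ} (hr : Tendsto r l atTop) (ht : Tendsto t l (nhds c)) :
    Tendsto (fun i => r i * ∫ z in Set.Iic (t i), exp (a * r i * (z - t i)) * g z) l
      (nhds (g c / a)) := by
  have hlim : Tendsto (fun i => ∫ u in Set.Iic 0, exp (a * u) * g (t i + u / r i)) l
      (nhds (∫ u in Set.Iic 0, exp (a * u) * g c)) := by
    refine tendsto_integral_filter_of_dominated_convergence (fun u => exp (a * u) * C) ?_ ?_ ?_ ?_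
    · exact Eventually.of_forall fun i => (by fun_prop : Continuous _).aestronglyMeasurable
    · refine Eventually.of_forall fun i => Eventually.of_forall fun u => ?_
      rw [norm_mul, norm_eq_abs, abs_exp, norm_eq_abs]
      gcongr
      exact hC _
    · exact (integrableOn_exp_mul_Iic ha 0).mul_const C
    · refine Eventually.of_forall fun u => Tendsto.const_mul _ ?_
      refine (hg.tendsto c).comp ?_
      simpa using ht.add (hr.const_div_atTop u)
  rw [integral_mul_const, integral_exp_mul_Iic ha, mul_zero, exp_zero, one_div_mul_eq_div] at hlim
  refine hlim.congr' ?_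
  filter_upwards [hr.eventually_gt_atTop 0] with i hi
  rw [mul_setIntegral_Iic_eq_setIntegral_Iic_zero _ _ hi]
  congr 1 with u
  congr 2
  field_simp
  ring

/-- Asymptotics of the main integral `I₁`:
`√d ∫_{-∞}^{θ_d} e^{2σ√d(z−θ_d)} e^{−z²/2} dz → e^{−c²/2}/(2σ)`. -/
theorem main_integral_asymptotics
    (σ : ℝ) (hσ : 0 < σ) (c : ℝ) (θ : ℕ → ℝ)
    (hθ : Tendsto θ atTop (nhds c)) :
    Tendsto
      (fun d : ℕ => Real.sqrt d *
        ∫ z in Set.Iic (θ d),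
          Real.exp (2 * σ * Real.sqrt d * (z - θ d)) * Real.exp (-z ^ 2 / 2))
      atTop (nhds (Real.exp (-c ^ 2 / 2) / (2 * σ))) := by
  refine tendsto_mul_setIntegral_Iic_exp_mul (g := fun z => exp (-z ^ 2 / 2)) (C := 1)
    (by fun_prop) (fun z => ?_) (by positivity)
    (tendsto_sqrt_atTop.comp tendsto_natCast_atTop_atTop) hθ
  rw [abs_exp, exp_le_one_iff]
  linarith [sq_nonneg z]
end
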